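/- Let α > 0, η > 2, and k ≥ 1. There exists t₀ ∈ ℕ (depending only on α, η, and k) such that: for every reward table X : ℕ → Fin k → [-1,1] and every pull sequence (i_t) consistent with the α-UCB policy applied to X, for all t ≥ t₀ and all arms i, the sample count satisfies N_i^{t−1} ≥ α·ln t/(2η²k²). -/

import Mathlib

namespace Freeride

variable {k : ℕ}

/-- Number of times arm `i` is pulled in rounds `1, …, t` by the pull sequence `I`. -/
def nCount (I : ℕ → Fin k) (i : Fin k) (t : ℕ) : ℕ :=
  ((Finset.Icc 1 t).filter fun s => I s = i).card

/-- Sample mean of arm `i` over rounds `1, …, t`, given reward table `X` and pulls `I`. -/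
noncomputable def sampleMean (X : ℕ → Fin k → ℝ) (I : ℕ → Fin k) (i : Fin k) (t : ℕ) : ℝ :=
  (∑ s ∈ (Finset.Icc 1 t).filter fun s => I s = i, X s i) / nCount I i t

/-- The `α`-UCB index of arm `i` after round `t` (`⊤` for unpulled arms). -/
noncomputable def ucbVal (α : ℝ) (X : ℕ → Fin k → ℝ) (I : ℕ → Fin k) (i : Fin k) (t : ℕ) :
    EReal :=
  if nCount I i t = 0 then ⊤
  else ((sampleMean X I i t +
    Real.sqrt (α * Real.log (t + 1) / (2 * nCount I i t)) : ℝ) : EReal)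

/-- The pull sequence `I` is consistent with the `α`-UCB policy on reward table `X`:
the arm pulled in round `t+1` maximizes the `α`-UCB index after round `t`. -/
def IsUCB (α : ℝ) (X : ℕ → Fin k → ℝ) (I : ℕ → Fin k) : Prop :=
  ∀ t : ℕ, ∀ j : Fin k, ucbVal α X I j t ≤ ucbVal α X I (I (t + 1)) t


lemma nCount_mono (I : ℕ → Fin k) (i : Fin k) : Monotone (nCount I i) := fun _ _ h =>
  Finset.card_le_card (Finset.filter_subset_filter _ (Finset.Icc_subset_Icc_right h))

lemma nCount_lt_nCount_succ (I : ℕ → Fin k) (s : ℕ) :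
    nCount I (I (s + 1)) s < nCount I (I (s + 1)) (s + 1) := by
  refine Finset.card_lt_card ((Finset.ssubset_iff_of_subset (Finset.filter_subset_filter _
    (Finset.Icc_subset_Icc_right s.le_succ))).2 ⟨s + 1, ?_, ?_⟩) <;> simp

lemma abs_sampleMean_le_one {X : ℕ → Fin k → ℝ} (hX : ∀ t i, X t i ∈ Set.Icc (-1 : ℝ) 1)
    (I : ℕ → Fin k) (i : Fin k) (t : ℕ) : |sampleMean X I i t| ≤ 1 := by
  rw [sampleMean, abs_div, Nat.abs_cast]
  refine div_le_one_of_le₀ ?_ (Nat.cast_nonneg _)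
  refine (Finset.abs_sum_le_sum_abs _ _).trans ?_
  refine (Finset.sum_le_card_nsmul _ _ 1 fun s _ => abs_le.2 (hX s i)).trans ?_
  simp [nCount]

/-- If some arm has exploration bonus at least `2 + δ`, then the arm pulled next has exploration
bonus at least `δ`. -/
lemma IsUCB.nCount_pulled_le {α δ : ℝ} (hδ : 0 < δ) {X : ℕ → Fin k → ℝ}
    (hX : ∀ t i, X t i ∈ Set.Icc (-1 : ℝ) 1) {I : ℕ → Fin k} (hI : IsUCB α X I) {s : ℕ}
    {i : Fin k} (hα : 0 ≤ α)
    (hi : 2 * (2 + δ) ^ 2 * (nCount I i s : ℝ) ≤ α * Real.log (s + 1)) :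
    2 * δ ^ 2 * (nCount I (I (s + 1)) s : ℝ) ≤ α * Real.log (s + 1) := by
  have hlog : 0 ≤ Real.log ((s : ℝ) + 1) := Real.log_nonneg (by simp)
  have h := hI s i
  by_cases hj : nCount I (I (s + 1)) s = 0
  · simp only [hj, Nat.cast_zero, mul_zero]
    positivity
  by_cases hi₀ : nCount I i s = 0
  · simp [ucbVal, hj, hi₀] at h
    exact absurd h (EReal.coe_ne_top _)
  simp only [ucbVal, hj, hi₀, if_false, EReal.coe_le_coe_iff] at h
  have hiu := neg_le_of_abs_le (abs_sampleMean_le_one hX I i s)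
  have hju := le_of_abs_le (abs_sampleMean_le_one hX I (I (s + 1)) s)
  have hi_pos : (0 : ℝ) < nCount I i s := by positivity
  have hj_pos : (0 : ℝ) < nCount I (I (s + 1)) s := by positivity
  have hbonus : 2 + δ ≤ √(α * Real.log (s + 1) / (2 * nCount I i s)) := by
    refine Real.le_sqrt_of_sq_le ?_
    rw [le_div_iff₀ (by positivity)]
    linarith
  have hpulled : δ ≤ √(α * Real.log (s + 1) / (2 * nCount I (I (s + 1)) s)) := by
    linarith
  rw [Real.le_sqrt' hδ, le_div_iff₀ (by positivity)] at hpulled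
  linarith

/-- If every arm pulled in rounds `m + 1, …, t` has been pulled at most `L` times before, there are
at most `k * (L + 1)` such rounds. -/
lemma sub_le_of_nCount_pulled_le (I : ℕ → Fin k) {m t L : ℕ}
    (h : ∀ s ∈ Finset.Ico m t, nCount I (I (s + 1)) s ≤ L) : t - m ≤ k * (L + 1) := by
  have hcard := Finset.card_le_card_of_injOn (s := Finset.Ico m t)
    (t := (Finset.univ : Finset (Fin k)) ×ˢ Finset.range (L + 1))
    (fun s => (I (s + 1), nCount I (I (s + 1)) s))
    (fun s hs => by simpa [Nat.lt_succ_iff] using h s hs) ?_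
  · simpa using hcard
  have hlt : ∀ {a b : ℕ}, a < b → I (a + 1) = I (b + 1) →
      nCount I (I (a + 1)) a < nCount I (I (b + 1)) b := fun {a b} hab hI => by
    rw [← hI]
    exact (nCount_lt_nCount_succ I a).trans_le (nCount_mono I _ hab)
  intro a _ b _ hab
  obtain ⟨hI, hN⟩ := Prod.mk.inj hab
  rcases lt_trichotomy a b with hlt' | rfl | hlt'
  · exact absurd hN (hlt hlt' hI).ne
  · rfl
  · exact absurd hN (hlt hlt' hI.symm).ne'

lemma eventually_mul_log_add_lt_half (a b : ℝ) :
    ∀ᶠ t : ℕ in Filter.atTop, a * Real.log t + b < (t : ℝ) / 2 := by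
  have h : (fun x : ℝ => a * Real.log x + b) =o[Filter.atTop] (id : ℝ → ℝ) :=
    (Real.isLittleO_log_id_atTop.const_mul_left a).add (Asymptotics.isLittleO_const_id_atTop b)
  filter_upwards [tendsto_natCast_atTop_atTop.eventually
    (h.def (show (0 : ℝ) < 1 / 4 by norm_num)), Filter.eventually_gt_atTop 0] with t ht hpos
  have ht' : (0 : ℝ) < t := by exact_mod_cast hpos
  rw [id, Real.norm_eq_abs, Real.norm_of_nonneg ht'.le] at ht
  linarith [le_abs_self (a * Real.log t + b)]

/-- A player following `α`-UCB pulls every arm at least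
`α ln t / (2 η² k²)` times by round `t - 1`, for all sufficiently large `t`. -/
theorem statement2 (α η : ℝ) (hα : 0 < α) (hη : 2 < η) (k : ℕ) (hk : 1 ≤ k) :
    ∃ t₀ : ℕ, ∀ X : ℕ → Fin k → ℝ, (∀ t i, X t i ∈ Set.Icc (-1 : ℝ) 1) →
      ∀ I : ℕ → Fin k, IsUCB α X I →
        ∀ t : ℕ, t₀ ≤ t → ∀ i : Fin k,
          α * Real.log t / (2 * η ^ 2 * (k : ℝ) ^ 2) ≤ (nCount I i (t - 1) : ℝ) := by
  set δ : ℝ := (η - 2) / 2 with hδ_def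
  have hδ : 0 < δ := by linarith
  have hgap : 0 < η ^ 2 - (2 + δ) ^ 2 := by nlinarith
  have hk' : (1 : ℝ) ≤ k := by exact_mod_cast hk
  obtain ⟨t₀, ht₀⟩ := Filter.eventually_atTop.1
    (((Filter.eventually_gt_atTop 0).and (eventually_mul_log_add_lt_half
      (k * (α / (2 * δ ^ 2))) k)).and
    ((Real.tendsto_log_atTop.comp tendsto_natCast_atTop_atTop).eventually_ge_atTop
      (η ^ 2 * Real.log 2 / (η ^ 2 - (2 + δ) ^ 2))))
  refine ⟨t₀, fun X hX I hI t ht i => ?_⟩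
  obtain ⟨⟨htpos, hcount⟩, hlog⟩ := ht₀ t ht
  rw [Function.comp_apply, div_le_iff₀ hgap] at hlog
  have htpos' : (0 : ℝ) < t := by exact_mod_cast htpos
  have hlogt : 0 ≤ Real.log t := Real.log_natCast_nonneg t
  by_contra! hlt
  have hfew : 2 * η ^ 2 * (nCount I i (t - 1) : ℝ) ≤ α * Real.log t := by
    rw [lt_div_iff₀ (by positivity)] at hlt
    have hk2 : (1 : ℝ) ≤ (k : ℝ) ^ 2 := one_le_pow₀ hk'
    have hN : (0 : ℝ) ≤ 2 * η ^ 2 * nCount I i (t - 1) := by positivity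
    nlinarith
  have hhalf : t - t / 2 ≤ k * (⌊α / (2 * δ ^ 2) * Real.log t⌋₊ + 1) := by
    refine sub_le_of_nCount_pulled_le I fun s hs => Nat.le_floor ?_
    obtain ⟨hs₁, hs₂⟩ := Finset.mem_Ico.1 hs
    have hs_half : (t : ℝ) / 2 ≤ s + 1 := by
      rw [div_le_iff₀ two_pos]
      exact_mod_cast (by omega : t ≤ (s + 1) * 2)
    have hs_le : (s : ℝ) + 1 ≤ t := by exact_mod_cast hs₂
    have hlog_le : Real.log ((s : ℝ) + 1) ≤ Real.log t := Real.log_le_log (by positivity) hs_le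
    have hlog_ge : Real.log t - Real.log 2 ≤ Real.log ((s : ℝ) + 1) := by
      rw [← Real.log_div htpos'.ne' two_ne_zero]
      exact Real.log_le_log (by positivity) hs_half
    have hmono : (nCount I i s : ℝ) ≤ nCount I i (t - 1) := by
      exact_mod_cast nCount_mono I i (Nat.le_sub_one_of_lt hs₂)
    have hratio : (2 + δ) ^ 2 * Real.log t ≤ η ^ 2 * Real.log ((s : ℝ) + 1) := by
      nlinarith [mul_le_mul_of_nonneg_left hlog_ge (sq_nonneg η)]
    have hbonus : 2 * (2 + δ) ^ 2 * (nCount I i s : ℝ) ≤ α * Real.log (s + 1) := by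
      have hη2 : 0 < η ^ 2 := by positivity
      refine le_of_mul_le_mul_left ?_ hη2
      calc η ^ 2 * (2 * (2 + δ) ^ 2 * (nCount I i s : ℝ))
          = (2 + δ) ^ 2 * (2 * η ^ 2 * nCount I i s) := by ring
        _ ≤ (2 + δ) ^ 2 * (2 * η ^ 2 * nCount I i (t - 1)) := by gcongr
        _ ≤ (2 + δ) ^ 2 * (α * Real.log t) := by gcongr
        _ = α * ((2 + δ) ^ 2 * Real.log t) := by ring
        _ ≤ α * (η ^ 2 * Real.log ((s : ℝ) + 1)) := by gcongr
        _ = η ^ 2 * (α * Real.log (s + 1)) := by ring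
    have hpulled := hI.nCount_pulled_le hδ hX hα.le hbonus
    rw [div_mul_eq_mul_div, le_div_iff₀ (by positivity)]
    nlinarith
  have hfloor := Nat.floor_le (show 0 ≤ α / (2 * δ ^ 2) * Real.log t by positivity)
  have hhalf' : (t : ℝ) / 2 ≤ k * (⌊α / (2 * δ ^ 2) * Real.log t⌋₊ + 1) := by
    rw [div_le_iff₀ two_pos]
    exact_mod_cast (by omega : t ≤ k * (⌊α / (2 * δ ^ 2) * Real.log t⌋₊ + 1) * 2)
  nlinarith [mul_le_mul_of_nonneg_left hfloor (zero_le_one.trans hk')]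

end Freeride
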